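/- Let K₀ be a nonzero real constant and I, J ⊆ ℝ open intervals. There do not exist smooth functions f : I → ℝ and g : J → ℝ such that (f(y)g'(z))² − (f'(y)g(z))² ≠ 0 and f(y)g(z)f''(y)g''(z) − (f'(y)g'(z))² = K₀·((f(y)g'(z))² − (f'(y)g(z))²)² for all (y,z) ∈ I×J. That is, there exists no factorable surface of second kind in the pseudo-Galilean space with nonzero constant Gaussian curvature. -/

import Mathlib

/-- Every three points of `U` satisfy a common nontrivial linear relation among
`f' ^ 2`, `f ^ 4`, `f ^ 2 * f' ^ 2` and `f' ^ 4`. -/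
def DegenerateOn (f : ℝ → ℝ) (U : Set ℝ) : Prop :=
  ∀ y : Fin 3 → ℝ, (∀ i, y i ∈ U) → ∃ c : Fin 3 → ℝ, c ≠ 0 ∧
    ∑ i, c i * deriv f (y i) ^ 2 = 0 ∧ ∑ i, c i * (f (y i) ^ 2) ^ 2 = 0 ∧
    ∑ i, c i * (f (y i) ^ 2 * deriv f (y i) ^ 2) = 0 ∧ ∑ i, c i * (deriv f (y i) ^ 2) ^ 2 = 0

theorem not_linearIndependent_of_orthogonal_triples (v w : Fin 3 → EuclideanSpace ℝ (Fin 5))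
    (h : ∀ i j, inner ℝ (w j) (v i) = 0) :
    ¬ LinearIndependent ℝ v ∨ ¬ LinearIndependent ℝ w := by
  by_contra! ⟨hv, hw⟩
  have h1 := finrank_span_eq_card hv
  have h2 := finrank_span_eq_card hw
  have hle : Submodule.span ℝ (Set.range v) ≤ (Submodule.span ℝ (Set.range w))ᗮ := by
    rw [Submodule.span_le]
    rintro _ ⟨i, rfl⟩
    rw [SetLike.mem_coe, Submodule.mem_orthogonal]
    intro x hx
    induction hx using Submodule.span_induction with
    | mem x hx => obtain ⟨j, rfl⟩ := hx; exact h i j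
    | zero => simp
    | add x y _ _ hx hy => rw [inner_add_left, hx, hy, add_zero]
    | smul a x _ hx => rw [inner_smul_left, hx, mul_zero]
  have h3 := Submodule.finrank_mono hle
  have h4 := (Submodule.span ℝ (Set.range w)).finrank_add_finrank_orthogonal
  simp only [finrank_euclideanSpace, Fintype.card_fin] at h1 h2 h4
  omega

theorem degenerateOn_or_degenerateOn {K₀ : ℝ} (hK₀ : K₀ ≠ 0) {I J : Set ℝ} {f g : ℝ → ℝ}
    (heq : ∀ y ∈ I, ∀ z ∈ J,
      f y * g z * deriv (deriv f) y * deriv (deriv g) z - (deriv f y * deriv g z) ^ 2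
        = K₀ * ((f y * deriv g z) ^ 2 - (deriv f y * g z) ^ 2) ^ 2) :
    DegenerateOn f I ∨ DegenerateOn g J := by
  by_contra! ⟨hI, hJ⟩
  simp only [DegenerateOn, not_forall] at hI hJ
  obtain ⟨y, hy, hy'⟩ := hI
  obtain ⟨z, hz, hz'⟩ := hJ
  let v : Fin 3 → EuclideanSpace ℝ (Fin 5) := fun i =>
    !₂[f (y i) * deriv (deriv f) (y i), deriv f (y i) ^ 2, (f (y i) ^ 2) ^ 2,
      f (y i) ^ 2 * deriv f (y i) ^ 2, (deriv f (y i) ^ 2) ^ 2]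
  let w : Fin 3 → EuclideanSpace ℝ (Fin 5) := fun j =>
    !₂[g (z j) * deriv (deriv g) (z j), -deriv g (z j) ^ 2, -K₀ * (deriv g (z j) ^ 2) ^ 2,
      2 * K₀ * (g (z j) ^ 2 * deriv g (z j) ^ 2), -K₀ * (g (z j) ^ 2) ^ 2]
  have horth : ∀ i j, inner ℝ (w j) (v i) = 0 := by
    intro i j
    simp only [v, w, PiLp.inner_apply, Fin.sum_univ_five]
    simp
    linear_combination heq (y i) (hy i) (z j) (hz j)
  rcases not_linearIndependent_of_orthogonal_triples v w horth with h | h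
  · rw [Fintype.not_linearIndependent_iff] at h
    obtain ⟨c, hc, i, hi⟩ := h
    refine hy' ⟨c, fun h0 => hi (congrFun h0 i), ?_, ?_, ?_, ?_⟩
    · simpa [v, Fin.sum_univ_three] using congrArg (fun x => x 1) hc
    · simpa [v, Fin.sum_univ_three] using congrArg (fun x => x 2) hc
    · simpa [v, Fin.sum_univ_three] using congrArg (fun x => x 3) hc
    · simpa [v, Fin.sum_univ_three] using congrArg (fun x => x 4) hc
  · rw [Fintype.not_linearIndependent_iff] at h
    obtain ⟨c, hc, i, hi⟩ := h
    have h1 := congrArg (fun x => x 1) hc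
    have h2 := congrArg (fun x => x 2) hc
    have h3 := congrArg (fun x => x 3) hc
    have h4 := congrArg (fun x => x 4) hc
    simp [w, Fin.sum_univ_three] at h1 h2 h3 h4
    refine hz' ⟨c, fun h0 => hi (congrFun h0 i), ?_, ?_, ?_, ?_⟩ <;>
      simp only [Fin.sum_univ_three]
    · linear_combination -h1
    · apply mul_left_cancel₀ hK₀
      linear_combination -h4
    · apply mul_left_cancel₀ hK₀
      linear_combination h3 / 2
    · apply mul_left_cancel₀ hK₀
      linear_combination -h2

/-- If a nontrivial affine relation holds among the points `(uᵢ, xᵢ)` and `u₁ ≠ u₂`, then the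
third point lies on the line through the first two. -/
theorem affine_of_relation {c₁ c₂ c₃ u₁ u₂ u₃ x₁ x₂ x₃ : ℝ} (hu : u₁ ≠ u₂)
    (hc : ¬ (c₁ = 0 ∧ c₂ = 0 ∧ c₃ = 0)) (h0 : c₁ + c₂ + c₃ = 0)
    (h1 : c₁ * u₁ + c₂ * u₂ + c₃ * u₃ = 0) (h2 : c₁ * x₁ + c₂ * x₂ + c₃ * x₃ = 0) :
    x₃ = (x₁ * u₂ - x₂ * u₁) / (u₂ - u₁) + (x₂ - x₁) / (u₂ - u₁) * u₃ := by
  have hu' : u₂ - u₁ ≠ 0 := sub_ne_zero.mpr hu.symm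
  have hc3 : c₃ ≠ 0 := by
    rintro rfl
    have hc2 : c₂ = 0 := by
      apply mul_right_cancel₀ hu'
      linear_combination h1 - u₁ * h0
    exact hc ⟨by linarith, hc2, rfl⟩
  field_simp
  apply mul_left_cancel₀ hc3
  linear_combination (u₂ - u₁) * h2 + (x₁ * u₁ - x₁ * u₂) * h0 - (x₂ - x₁) * (h1 - u₁ * h0)

theorem quadratic_coeffs_eq_zero {a b c x y z : ℝ} (hxy : x ≠ y) (hxz : x ≠ z) (hyz : y ≠ z)
    (hx : a + b * x + c * x ^ 2 = 0) (hy : a + b * y + c * y ^ 2 = 0)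
    (hz : a + b * z + c * z ^ 2 = 0) : a = 0 ∧ b = 0 ∧ c = 0 := by
  have h1 : b + c * (x + y) = 0 := by
    apply mul_left_cancel₀ (sub_ne_zero.mpr hxy)
    linear_combination hx - hy
  have h2 : b + c * (x + z) = 0 := by
    apply mul_left_cancel₀ (sub_ne_zero.mpr hxz)
    linear_combination hx - hz
  have hc : c = 0 := by
    apply mul_left_cancel₀ (sub_ne_zero.mpr hyz)
    linear_combination h1 - h2
  subst hc
  have hb : b = 0 := by linarith
  subst hb
  exact ⟨by linarith, rfl, rfl⟩

theorem infinite_image_sq {f : ℝ → ℝ} {U : Set ℝ} (hUo : IsOpen U) (hUc : IsPreconnected U)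
    (hUn : U.Nonempty) (hf : DifferentiableOn ℝ f U) (hf' : ∀ y ∈ U, deriv f y ≠ 0) :
    ((fun y => f y ^ 2) '' U).Infinite := by
  have hpre : IsPreconnected ((fun y => f y ^ 2) '' U) := hUc.image _ (hf.continuousOn.pow 2)
  apply hpre.infinite_of_nontrivial
  by_contra hsub
  rw [Set.not_nontrivial_iff] at hsub
  have hzero : ∀ y ∈ U, f y = 0 := by
    intro y hy
    have hd := ((hf.differentiableAt (hUo.mem_nhds hy)).hasDerivAt.pow 2).deriv
    have hc : f ^ 2 =ᶠ[nhds y] fun _ => f y ^ 2 := by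
      filter_upwards [hUo.mem_nhds hy] with x hx
      exact hsub ⟨x, hx, rfl⟩ ⟨y, hy, rfl⟩
    rw [hc.deriv_eq, deriv_const] at hd
    simpa [hf' y hy] using hd
  obtain ⟨y, hy⟩ := hUn
  have hc : f =ᶠ[nhds y] fun _ => 0 := by
    filter_upwards [hUo.mem_nhds hy] with x hx using hzero x hx
  exact hf' y hy (by rw [hc.deriv_eq, deriv_const])

theorem DegenerateOn.exists_sq_deriv_eq {f : ℝ → ℝ} {U : Set ℝ} (hdeg : DegenerateOn f U)
    (hinf : ((fun y => f y ^ 2) '' U).Infinite) (hf' : ∀ y ∈ U, deriv f y ≠ 0) :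
    ∃ β, ∀ y ∈ U, deriv f y ^ 2 = β * f y ^ 2 := by
  obtain ⟨_, ⟨y₁, hy₁, rfl⟩, -⟩ := hinf.exists_notMem_finset ∅
  obtain ⟨_, ⟨y₂, hy₂, rfl⟩, h2⟩ := hinf.exists_notMem_finset {f y₁ ^ 2}
  obtain ⟨_, ⟨y₃, hy₃, rfl⟩, h3⟩ := hinf.exists_notMem_finset {f y₁ ^ 2, f y₂ ^ 2}
  simp only [Finset.mem_singleton, Finset.mem_insert, not_or] at h2 h3
  obtain ⟨α, β, γ, δ, hlin⟩ : ∃ α β γ δ : ℝ, ∀ y ∈ U, deriv f y ^ 2 = α + β * f y ^ 2 ∧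
      (f y ^ 2) ^ 2 / deriv f y ^ 2 = γ + δ * f y ^ 2 := by
    let a : ℝ → ℝ := fun y => (f y ^ 2) ^ 2 / deriv f y ^ 2
    refine ⟨(deriv f y₁ ^ 2 * f y₂ ^ 2 - deriv f y₂ ^ 2 * f y₁ ^ 2) / (f y₂ ^ 2 - f y₁ ^ 2),
      (deriv f y₂ ^ 2 - deriv f y₁ ^ 2) / (f y₂ ^ 2 - f y₁ ^ 2),
      (a y₁ * f y₂ ^ 2 - a y₂ * f y₁ ^ 2) / (f y₂ ^ 2 - f y₁ ^ 2),
      (a y₂ - a y₁) / (f y₂ ^ 2 - f y₁ ^ 2), fun y hy => ?_⟩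
    obtain ⟨c, hc, e1, e2, e3, e4⟩ := hdeg ![y₁, y₂, y] (by simp [Fin.forall_fin_succ, *])
    simp [Fin.sum_univ_three] at e1 e2 e3 e4
    have p1 := hf' y₁ hy₁
    have p2 := hf' y₂ hy₂
    have p3 := hf' y hy
    have hc' : ¬ (c 0 * deriv f y₁ ^ 2 = 0 ∧ c 1 * deriv f y₂ ^ 2 = 0 ∧
        c 2 * deriv f y ^ 2 = 0) := by
      rintro ⟨a, b, d⟩
      apply hc
      ext i
      fin_cases i <;> simp_all
    have e3' : c 0 * deriv f y₁ ^ 2 * f y₁ ^ 2 + c 1 * deriv f y₂ ^ 2 * f y₂ ^ 2 +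
        c 2 * deriv f y ^ 2 * f y ^ 2 = 0 := by linear_combination e3
    constructor
    · exact affine_of_relation (Ne.symm h2) hc' e1 e3' (by linear_combination e4)
    · refine affine_of_relation (Ne.symm h2) hc' e1 e3' ?_
      simp only [a]
      field_simp
      linear_combination e2
  have hquad : ∀ y ∈ U, α * γ + (α * δ + β * γ) * f y ^ 2 + (β * δ - 1) * (f y ^ 2) ^ 2 = 0 := by
    intro y hy
    obtain ⟨ha, hb⟩ := hlin y hy
    have hp : deriv f y ^ 2 ≠ 0 := pow_ne_zero 2 (hf' y hy)
    rw [div_eq_iff hp, ha] at hb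
    linear_combination -hb
  obtain ⟨q0, q1, q2⟩ := quadratic_coeffs_eq_zero (Ne.symm h2) (Ne.symm h3.1) (Ne.symm h3.2)
    (hquad y₁ hy₁) (hquad y₂ hy₂) (hquad y₃ hy₃)
  have hα : α = 0 := by
    apply pow_eq_zero_iff two_ne_zero |>.mp
    linear_combination -α ^ 2 * q2 + β * (α * q1 - β * q0)
  refine ⟨β, fun y hy => ?_⟩
  rw [(hlin y hy).1, hα, zero_add]

theorem not_degenerateOn {K₀ : ℝ} (hK₀ : K₀ ≠ 0) {U J : Set ℝ} {f g : ℝ → ℝ}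
    (hUo : IsOpen U) (hUc : IsPreconnected U) (hUn : U.Nonempty) (hJn : J.Nonempty)
    (hf : ContDiffOn ℝ (⊤ : ℕ∞) f U) (hf' : ∀ y ∈ U, deriv f y ≠ 0)
    (hnl : ∀ y ∈ U, ∀ z ∈ J, (f y * deriv g z) ^ 2 - (deriv f y * g z) ^ 2 ≠ 0)
    (heq : ∀ y ∈ U, ∀ z ∈ J,
      f y * g z * deriv (deriv f) y * deriv (deriv g) z - (deriv f y * deriv g z) ^ 2
        = K₀ * ((f y * deriv g z) ^ 2 - (deriv f y * g z) ^ 2) ^ 2) :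
    ¬ DegenerateOn f U := by
  intro hdeg
  have hfd : DifferentiableOn ℝ f U := hf.differentiableOn (by simp)
  have hfd' : DifferentiableOn ℝ (deriv f) U :=
    (hf.deriv_of_isOpen (m := 1) hUo (WithTop.coe_le_coe.2 le_top)).differentiableOn (by simp)
  have hinf := infinite_image_sq hUo hUc hUn hfd hf'
  obtain ⟨β, hβ⟩ := hdeg.exists_sq_deriv_eq hinf hf'
  have hf'' : ∀ y ∈ U, deriv (deriv f) y = β * f y := by
    intro y hy
    have hl := ((hfd'.differentiableAt (hUo.mem_nhds hy)).hasDerivAt.pow 2).deriv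
    have hr := (((hfd.differentiableAt (hUo.mem_nhds hy)).hasDerivAt.pow 2).const_mul β).deriv
    have hc : deriv f ^ 2 =ᶠ[nhds y] fun x => β * (f ^ 2) x := by
      filter_upwards [hUo.mem_nhds hy] with x hx using hβ x hx
    rw [hc.deriv_eq, hr] at hl
    apply mul_left_cancel₀ (hf' y hy)
    simp at hl
    linear_combination -hl / 2
  obtain ⟨z, hz⟩ := hJn
  have key : ∀ y ∈ U, f y ≠ 0 ∧ β * (g z * deriv (deriv g) z - deriv g z ^ 2) =
      K₀ * (deriv g z ^ 2 - β * g z ^ 2) ^ 2 * f y ^ 2 := by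
    intro y hy
    have hy0 : f y ≠ 0 := by
      intro h0
      have := hβ y hy
      simp [h0, hf' y hy] at this
    refine ⟨hy0, ?_⟩
    have h := heq y hy z hz
    rw [hf'' y hy, mul_pow, mul_pow, mul_pow, hβ y hy] at h
    apply mul_left_cancel₀ (pow_ne_zero 2 hy0)
    linear_combination h
  obtain ⟨_, ⟨y₁, hy₁, rfl⟩, -⟩ := hinf.exists_notMem_finset ∅
  obtain ⟨_, ⟨y₂, hy₂, rfl⟩, h2⟩ := hinf.exists_notMem_finset {f y₁ ^ 2}
  have hne : deriv g z ^ 2 - β * g z ^ 2 ≠ 0 := by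
    intro h0
    apply hnl y₁ hy₁ z hz
    rw [mul_pow, mul_pow, hβ y₁ hy₁]
    linear_combination f y₁ ^ 2 * h0
  apply h2
  rw [Finset.mem_singleton]
  apply mul_left_cancel₀ (mul_ne_zero hK₀ (pow_ne_zero 2 hne))
  rw [← (key y₁ hy₁).2, ← (key y₂ hy₂).2]

theorem exists_subset_deriv_ne_zero {K₀ : ℝ} (hK₀ : K₀ ≠ 0) {I J : Set ℝ} {f g : ℝ → ℝ}
    (hIo : IsOpen I) (hIn : I.Nonempty) (hJn : J.Nonempty) (hf : ContDiffOn ℝ (⊤ : ℕ∞) f I)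
    (hnl : ∀ y ∈ I, ∀ z ∈ J, (f y * deriv g z) ^ 2 - (deriv f y * g z) ^ 2 ≠ 0)
    (heq : ∀ y ∈ I, ∀ z ∈ J,
      f y * g z * deriv (deriv f) y * deriv (deriv g) z - (deriv f y * deriv g z) ^ 2
        = K₀ * ((f y * deriv g z) ^ 2 - (deriv f y * g z) ^ 2) ^ 2) :
    ∃ U ⊆ I, IsOpen U ∧ IsPreconnected U ∧ U.Nonempty ∧ ∀ y ∈ U, deriv f y ≠ 0 := by
  obtain ⟨y, hy, hy'⟩ : ∃ y ∈ I, deriv f y ≠ 0 := by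
    by_contra! hzero
    obtain ⟨y, hy⟩ := hIn
    obtain ⟨z, hz⟩ := hJn
    have hc : deriv f =ᶠ[nhds y] fun _ => 0 := by
      filter_upwards [hIo.mem_nhds hy] with x hx using hzero x hx
    have hdd : deriv (deriv f) y = 0 := by rw [hc.deriv_eq, deriv_const]
    have h := heq y hy z hz
    rw [hdd, hzero y hy] at h
    have h' := hnl y hy z hz
    rw [hzero y hy] at h'
    apply mul_ne_zero hK₀ (pow_ne_zero 2 h')
    linear_combination -h
  have hcont : ContinuousAt (deriv f) y :=
    (hf.continuousOn_deriv_of_isOpen hIo (by simp)).continuousAt (hIo.mem_nhds hy)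
  obtain ⟨r, hr, hball⟩ := Metric.mem_nhds_iff.mp
    (Filter.inter_mem (hIo.mem_nhds hy) (hcont.eventually_ne hy'))
  exact ⟨Metric.ball y r, fun x hx => (hball hx).1, Metric.isOpen_ball,
    (convex_ball y r).isPreconnected, ⟨y, Metric.mem_ball_self hr⟩, fun x hx => (hball hx).2⟩

/-- There does not exist a factorable surface of second kind `x(y,z) = f(y) g(z)` in the
pseudo-Galilean space having nonzero constant Gaussian curvature. -/
theorem no_factorable_second_kind_constant_gauss_curvature
    (K₀ : ℝ) (hK₀ : K₀ ≠ 0)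
    (I J : Set ℝ) (hIo : IsOpen I) (hIc : I.OrdConnected) (hIn : I.Nonempty)
    (hJo : IsOpen J) (hJc : J.OrdConnected) (hJn : J.Nonempty)
    (f g : ℝ → ℝ) (hf : ContDiffOn ℝ (⊤ : ℕ∞) f I) (hg : ContDiffOn ℝ (⊤ : ℕ∞) g J)
    (hnl : ∀ y ∈ I, ∀ z ∈ J, (f y * deriv g z) ^ 2 - (deriv f y * g z) ^ 2 ≠ 0)
    (heq : ∀ y ∈ I, ∀ z ∈ J,
      f y * g z * deriv (deriv f) y * deriv (deriv g) z - (deriv f y * deriv g z) ^ 2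
        = K₀ * ((f y * deriv g z) ^ 2 - (deriv f y * g z) ^ 2) ^ 2) :
    False := by
  have hnl' : ∀ z ∈ J, ∀ y ∈ I, (g z * deriv f y) ^ 2 - (deriv g z * f y) ^ 2 ≠ 0 := by
    intro z hz y hy h
    apply hnl y hy z hz
    linear_combination -h
  have heq' : ∀ z ∈ J, ∀ y ∈ I,
      g z * f y * deriv (deriv g) z * deriv (deriv f) y - (deriv g z * deriv f y) ^ 2
        = K₀ * ((g z * deriv f y) ^ 2 - (deriv g z * f y) ^ 2) ^ 2 := by
    intro z hz y hy
    linear_combination heq y hy z hz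
  obtain ⟨U, hUI, hUo, hUc, hUn, hU⟩ :=
    exists_subset_deriv_ne_zero hK₀ hIo hIn hJn hf hnl heq
  obtain ⟨V, hVJ, hVo, hVc, hVn, hV⟩ :=
    exists_subset_deriv_ne_zero hK₀ hJo hJn hIn hg hnl' heq'
  rcases degenerateOn_or_degenerateOn hK₀
    (fun y hy z hz => heq y (hUI hy) z (hVJ hz)) with h | h
  · exact not_degenerateOn hK₀ hUo hUc hUn hJn (hf.mono hUI) hU
      (fun y hy => hnl y (hUI hy)) (fun y hy => heq y (hUI hy)) h
  · exact not_degenerateOn hK₀ hVo hVc hVn hIn (hg.mono hVJ) hV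
      (fun z hz => hnl' z (hVJ hz)) (fun z hz => heq' z (hVJ hz)) h
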